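/- Let S be a string of length N over a linearly ordered alphabet with RL factorization a_1^{p_1}⋯a_n^{p_n} and s-factorization f_1⋯f_m. Fix j, let ℓ = |f_1⋯f_{j-1}| + 1 be the starting position of f_j, let d = min{ t : Σ_{i=1}^{t} p_i ≥ ℓ } + 1 (so the (d−1)-th RL factor contains position ℓ), and let q = Σ_{i=1}^{d-1} p_i − ℓ + 1 (so 1 ≤ q ≤ p_{d-1}). Assume d ≤ n. Let k = max({ p_i : a_i = a_{d-1}, 1 ≤ i ≤ d−2 } ∪ {0}) and assume q < p_{d-1} or q ≤ k. Define x_1 = max{ u : 1 < rs(u) < d, u < rr(d), a_{rs(u)−1} = a_{d-1}, p_{rs(u)−1} ≥ q } and x_2 = min{ v : 1 < rs(v) < d, rr(d) < v, a_{rs(v)−1} = a_{d-1}, p_{rs(v)−1} ≥ q }, each defined only when the corresponding set is nonempty. Then |f_j| = q + max M, where M contains |lcp(val(RLE_S[rs(x_1)..n]), val(RLE_S[d..n]))| if x_1 is defined, contains |lcp(val(RLE_S[d..n]), val(RLE_S[rs(x_2)..n]))| if x_2 is defined, and contains 0. -/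

import Mathlib

variable {α : Type*}

/-- Decompress a run-length encoding: each pair `(a, p)` stands for `a^p`. -/
def rleDecode (l : List (α × ℕ)) : List α :=
  (l.map fun ap => List.replicate ap.2 ap.1).flatten

/-- `l` is the run-length factorization of `S`: it decodes to `S`, all exponents are
positive, and adjacent factors carry distinct characters. -/
def IsRLE (S : List α) (l : List (α × ℕ)) : Prop :=
  rleDecode l = S ∧ (∀ ap ∈ l, 1 ≤ ap.2) ∧ l.Chain' (fun x y => x.1 ≠ y.1)

/-- `f` has an occurrence in `S` starting at a (0-indexed) position strictly before `ℓ`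
(the occurrence may extend past position `ℓ`, allowing self-references). -/
def OccursBefore (S : List α) (ℓ : ℕ) (f : List α) : Prop :=
  ∃ j < ℓ, f <+: S.drop j

/-- `fs` is the s-factorization of `S` (LZ factorization with self-references):
the factors are nonempty and concatenate to `S`; the first factor is the first
character; and each subsequent factor starting at (0-indexed) position `ℓ`
with first character `c` is `[c]` if `c` does not occur before position `ℓ`,
and otherwise is the longest prefix of the remainder that has an occurrence
in `S` starting strictly before position `ℓ` (possibly overlapping itself). -/
def IsSFactorization (S : List α) (fs : List (List α)) : Prop :=
  fs.flatten = S ∧ (∀ f ∈ fs, f ≠ []) ∧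
  ∀ i (h : i < fs.length), ∀ c, (fs.get ⟨i, h⟩).head? = some c →
    ((c ∉ (fs.take i).flatten → fs.get ⟨i, h⟩ = [c]) ∧
     (c ∈ (fs.take i).flatten →
        OccursBefore S ((fs.take i).flatten).length (fs.get ⟨i, h⟩) ∧
        ∀ f', f' <+: S.drop ((fs.take i).flatten).length →
          OccursBefore S ((fs.take i).flatten).length f' →
          f'.length ≤ (fs.get ⟨i, h⟩).length))

/-- The order `≺` on RL factors: `a^p ≺ b^q` iff `a < b`, or `a = b` and `p < q`. -/
def RLLt [LT α] (x y : α × ℕ) : Prop :=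
  x.1 < y.1 ∨ (x.1 = y.1 ∧ x.2 < y.2)

/-- Length of the longest common prefix of two lists. -/
def lcpLength [DecidableEq α] : List α → List α → ℕ
  | [], _ => 0
  | _, [] => 0
  | a :: x, b :: y => if a = b then lcpLength x y + 1 else 0

theorem prefix_iff_of_prefix_append {p f A B : List α} (hA : f <+: p ++ A) (hB : f <+: p ++ B) :
    f <+: p ∨ ∃ g, f = p ++ g ∧ g <+: A ∧ g <+: B := by
  rcases List.prefix_or_prefix_of_prefix hA (List.prefix_append p A) with h | ⟨g, rfl⟩
  · exact Or.inl h
  · exact Or.inr ⟨g, rfl, (List.prefix_append_right_inj p).1 hA,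
      (List.prefix_append_right_inj p).1 hB⟩

theorem le_lcpLength [DecidableEq α] {f x y : List α} (hx : f <+: x) (hy : f <+: y) :
    f.length ≤ lcpLength x y := by
  induction f generalizing x y with
  | nil => simp
  | cons a f ih =>
    obtain ⟨x, rfl⟩ := hx
    obtain ⟨y, rfl⟩ := hy
    simpa [lcpLength] using ih (List.prefix_append f x) (List.prefix_append f y)

theorem exists_prefix_length_eq_lcpLength [DecidableEq α] (x y : List α) :
    ∃ f, f.length = lcpLength x y ∧ f <+: x ∧ f <+: y := by
  induction x generalizing y with
  | nil => exact ⟨[], by simp [lcpLength]⟩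
  | cons a x ih =>
    cases y with
    | nil => exact ⟨[], by simp [lcpLength]⟩
    | cons b y =>
      by_cases h : a = b
      · obtain ⟨f, hf, hx, hy⟩ := ih y
        subst h
        exact ⟨a :: f, by simp [lcpLength, hf], by simpa using hx, by simpa using hy⟩
      · exact ⟨[], by simp [lcpLength, h]⟩

theorem rleDecode_cons (x : α × ℕ) (l : List (α × ℕ)) :
    rleDecode (x :: l) = List.replicate x.2 x.1 ++ rleDecode l := by
  simp [rleDecode]

theorem rleDecode_append (l₁ l₂ : List (α × ℕ)) :
    rleDecode (l₁ ++ l₂) = rleDecode l₁ ++ rleDecode l₂ := by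
  simp [rleDecode]

theorem length_rleDecode (l : List (α × ℕ)) :
    (rleDecode l).length = (l.map (·.2)).sum := by
  induction l with
  | nil => simp [rleDecode]
  | cons x l ih => simp [rleDecode_cons, ih]

theorem drop_rleDecode (l : List (α × ℕ)) (r : ℕ) :
    (rleDecode l).drop ((l.take r).map (·.2)).sum = rleDecode (l.drop r) := by
  conv_lhs => rw [← List.take_append_drop r l, rleDecode_append]
  rw [List.take_append_drop, ← length_rleDecode, List.drop_left]

theorem sum_take_succ (l : List (α × ℕ)) (r : ℕ) (hr : r < l.length) :
    ((l.take (r + 1)).map (·.2)).sum = ((l.take r).map (·.2)).sum + l[r].2 := by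
  rw [List.take_succ_eq_append_getElem hr, List.map_append, List.sum_append]
  simp

theorem sum_take_mono (l : List (α × ℕ)) {r s : ℕ} (h : r ≤ s) :
    ((l.take r).map (·.2)).sum ≤ ((l.take s).map (·.2)).sum := by
  rw [← length_rleDecode, ← length_rleDecode]
  obtain ⟨t, ht⟩ := List.take_prefix_take_left (l := l) h
  rw [← ht, rleDecode_append]
  simp

theorem drop_rleDecode_within_run (l : List (α × ℕ)) (r : ℕ) (hr : r < l.length) (j : ℕ)
    (h₁ : ((l.take r).map (·.2)).sum ≤ j) (h₂ : j ≤ ((l.take (r + 1)).map (·.2)).sum) :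
    (rleDecode l).drop j =
      List.replicate (((l.take (r + 1)).map (·.2)).sum - j) l[r].1 ++
        rleDecode (l.drop (r + 1)) := by
  obtain ⟨i, rfl⟩ := Nat.exists_eq_add_of_le h₁
  rw [sum_take_succ l r hr] at h₂ ⊢
  rw [← List.drop_drop, drop_rleDecode, List.drop_eq_getElem_cons hr, rleDecode_cons,
    List.drop_append_of_le_length (by simpa using h₂), List.drop_replicate, Nat.add_sub_add_left]

theorem exists_run_of_lt_length (l : List (α × ℕ)) (j : ℕ) (hj : j < (rleDecode l).length) :
    ∃ r < l.length, ((l.take r).map (·.2)).sum ≤ j ∧ j < ((l.take (r + 1)).map (·.2)).sum := by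
  classical
  have hex : ∃ r, j < ((l.take r).map (·.2)).sum := ⟨l.length, by
    simpa [length_rleDecode] using hj⟩
  obtain ⟨r, hr⟩ : ∃ r, Nat.find hex = r + 1 := Nat.exists_eq_succ_of_ne_zero (by
    intro h
    have h0 := Nat.find_spec hex
    rw [h] at h0
    simp at h0)
  have hmin := Nat.find_min hex (m := r) (by omega)
  have hspec := Nat.find_spec hex
  rw [hr] at hspec
  refine ⟨r, ?_, by omega, hspec⟩
  by_contra h
  rw [List.take_of_length_le (by omega)] at hspec hmin
  exact hmin hspec

theorem IsRLE.tail {S : List α} {x : α × ℕ} {l : List (α × ℕ)} (h : IsRLE S (x :: l)) :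
    IsRLE (rleDecode l) l :=
  ⟨rfl, fun ap hap => h.2.1 ap (List.mem_cons_of_mem _ hap), List.IsChain.tail h.2.2⟩

theorem IsRLE.drop {S : List α} {l : List (α × ℕ)} (h : IsRLE S l) (r : ℕ) :
    IsRLE (rleDecode (l.drop r)) (l.drop r) :=
  ⟨rfl, fun ap hap => h.2.1 ap (List.mem_of_mem_drop hap), List.IsChain.drop h.2.2 r⟩

theorem IsRLE.not_cons_prefix_tail {S : List α} {x : α × ℕ} {l : List (α × ℕ)}
    (h : IsRLE S (x :: l)) (t : List α) : ¬ x.1 :: t <+: rleDecode l := by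
  intro hp
  cases l with
  | nil => simp [rleDecode] at hp
  | cons y l =>
    have hy : 1 ≤ y.2 := h.2.1 y (by simp)
    obtain ⟨m, hm⟩ := Nat.exists_eq_add_of_le' hy
    rw [rleDecode_cons, hm, List.replicate_succ, List.cons_append, List.cons_prefix_cons] at hp
    exact (List.isChain_cons_cons.1 h.2.2).1 hp.1

theorem IsRLE.not_cons_prefix_drop_succ {S : List α} {l : List (α × ℕ)} (h : IsRLE S l)
    (r : ℕ) (hr : r < l.length) (t : List α) :
    ¬ l[r].1 :: t <+: rleDecode (l.drop (r + 1)) := by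
  have h' := h.drop r
  rw [List.drop_eq_getElem_cons hr] at h'
  exact h'.not_cons_prefix_tail t

/-- The decompressed common prefix of two run-length encodings is shared by every run-length
encoding that lies between them in the lexicographic order of factor sequences. -/
theorem prefix_rleDecode_of_lex_between [LinearOrder α] {X Y Z : List (α × ℕ)}
    (hX : IsRLE (rleDecode X) X) (hZ : IsRLE (rleDecode Z) Z)
    (hXY : List.Lex RLLt X Y) (hYZ : List.Lex RLLt Y Z) {f : List α}
    (hfX : f <+: rleDecode X) (hfZ : f <+: rleDecode Z) : f <+: rleDecode Y := by
  induction X generalizing Y Z f with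
  | nil =>
    have : f = [] := by simpa [rleDecode] using hfX
    simp [this]
  | cons x X ih =>
    obtain ⟨a, p⟩ := x
    rcases Y with _ | ⟨⟨c, r⟩, Y⟩
    · cases hXY
    rcases Z with _ | ⟨⟨b, q⟩, Z⟩
    · cases hYZ
    have hxy : RLLt (a, p) (c, r) ∨ (a = c ∧ p = r ∧ List.Lex RLLt X Y) := by
      cases hXY with
      | rel h => exact Or.inl h
      | cons h => exact Or.inr ⟨rfl, rfl, h⟩
    have hyz : RLLt (c, r) (b, q) ∨ (c = b ∧ r = q ∧ List.Lex RLLt Y Z) := by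
      cases hYZ with
      | rel h => exact Or.inl h
      | cons h => exact Or.inr ⟨rfl, rfl, h⟩
    simp only [RLLt] at hxy hyz
    have hp : 1 ≤ p := hX.2.1 (a, p) (by simp)
    have hq : 1 ≤ q := hZ.2.1 (b, q) (by simp)
    simp only [rleDecode_cons] at hfX hfZ ⊢
    by_cases hab : a = b
    · subst hab
      have hca : c = a := by
        apply le_antisymm
        · rcases hyz with (h | h) | h
          exacts [h.le, h.1.le, h.1.le]
        · rcases hxy with (h | h) | h
          exacts [h.le, h.1.le, h.1.le]
      subst hca
      simp only [lt_irrefl, false_or, true_and] at hxy hyz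
      have hpr : p ≤ r := by omega
      have hprep : List.replicate p c <+: List.replicate r c ++ rleDecode Y :=
        ⟨List.replicate (r - p) c ++ rleDecode Y, by
          rw [← List.append_assoc, List.replicate_append_replicate, Nat.add_sub_cancel' hpr]⟩
      obtain ⟨s, rfl⟩ : ∃ s, q = p + s := Nat.exists_eq_add_of_le (by omega)
      rw [← List.replicate_append_replicate, List.append_assoc] at hfZ
      rcases prefix_iff_of_prefix_append hfX hfZ with h | ⟨g, rfl, hgX, hgZ⟩
      · exact h.trans hprep
      · rcases Nat.eq_zero_or_pos s with rfl | hs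
        · obtain ⟨rfl, hXY'⟩ : p = r ∧ List.Lex RLLt X Y := hxy.resolve_left (by omega)
          have hYZ' := (hyz.resolve_left (by omega)).2
          exact (List.prefix_append_right_inj _).2
            (ih hX.tail hZ.tail hXY' hYZ' hgX (by simpa using hgZ))
        · rcases g with _ | ⟨e, g⟩
          · simpa using hprep
          · obtain ⟨s, rfl⟩ := Nat.exists_eq_add_of_le' hs
            rw [List.replicate_succ, List.cons_append, List.cons_prefix_cons] at hgZ
            rw [hgZ.1] at hgX
            exact absurd hgX (hX.not_cons_prefix_tail g)
    · rcases f with _ | ⟨e, f⟩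
      · simp
      · obtain ⟨p, rfl⟩ := Nat.exists_eq_add_of_le' hp
        obtain ⟨q, rfl⟩ := Nat.exists_eq_add_of_le' hq
        rw [List.replicate_succ, List.cons_append, List.cons_prefix_cons] at hfX hfZ
        exact absurd (hfX.1.symm.trans hfZ.1) hab

/-- A block of exactly `q` copies of `a` followed by another character can only match a maximal
run of length `m` from its start if the run consists of exactly `q` copies of `a`. -/
theorem eq_of_replicate_append_prefix {a b c : α} {q m : ℕ} {t R : List α} (hab : b ≠ a)
    (hq : 1 ≤ q) (hm : 1 ≤ m) (hR : ∀ t, ¬ c :: t <+: R)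
    (h : List.replicate q a ++ b :: t <+: List.replicate m c ++ R) :
    a = c ∧ m = q ∧ b :: t <+: R := by
  obtain ⟨q, rfl⟩ := Nat.exists_eq_add_of_le' hq
  obtain ⟨m, rfl⟩ := Nat.exists_eq_add_of_le' hm
  have hac : a = c := by
    rw [List.replicate_succ, List.replicate_succ, List.cons_append, List.cons_append,
      List.cons_prefix_cons] at h
    exact h.1
  subst hac
  rcases lt_trichotomy m q with hlt | rfl | hlt
  · obtain ⟨s, rfl⟩ := Nat.exists_eq_add_of_lt hlt
    rw [show m + s + 1 + 1 = (m + 1) + (s + 1) by omega, ← List.replicate_append_replicate,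
      List.append_assoc, List.prefix_append_right_inj, List.replicate_succ] at h
    exact absurd h (hR _)
  · exact ⟨rfl, rfl, (List.prefix_append_right_inj _).1 h⟩
  · obtain ⟨s, rfl⟩ := Nat.exists_eq_add_of_lt hlt
    rw [show q + s + 1 + 1 = (q + 1) + (s + 1) by omega,
      ← List.replicate_append_replicate (n := q + 1) (m := s + 1),
      List.append_assoc, List.prefix_append_right_inj, List.replicate_succ, List.cons_append,
      List.cons_prefix_cons] at h
    exact absurd h.1 hab

theorem exists_mem_le_of_le_foldr_max {q : ℕ} (hq : 1 ≤ q) (L : List ℕ)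
    (h : q ≤ L.foldr max 0) : ∃ p ∈ L, q ≤ p := by
  induction L with
  | nil => simp at h; omega
  | cons x L ih =>
    rcases le_max_iff.1 h with h | h
    · exact ⟨x, by simp, h⟩
    · obtain ⟨p, hp, hqp⟩ := ih h
      exact ⟨p, List.mem_cons_of_mem _ hp, hqp⟩

theorem IsSFactorization.get_prefix_drop {S : List α} {fs : List (List α)}
    (h : IsSFactorization S fs) (i : ℕ) (hi : i < fs.length) :
    fs.get ⟨i, hi⟩ <+: S.drop ((fs.take i).flatten).length := by
  have hS : S = (fs.take i).flatten ++ (fs.drop i).flatten := by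
    rw [← List.flatten_append, List.take_append_drop, h.1]
  rw [hS, List.drop_left, List.drop_eq_getElem_cons hi, List.flatten_cons]
  exact List.prefix_append _ _

theorem IsSFactorization.take_flatten_length {S : List α} {fs : List (List α)}
    (h : IsSFactorization S fs) (i : ℕ) :
    S.take ((fs.take i).flatten).length = (fs.take i).flatten := by
  have hS : S = (fs.take i).flatten ++ (fs.drop i).flatten := by
    rw [← List.flatten_append, List.take_append_drop, h.1]
  conv_lhs => rw [hS]
  rw [List.take_left]

theorem OccursBefore.head_mem_take {S : List α} {n : ℕ} {c : α} {f : List α}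
    (h : OccursBefore S n (c :: f)) : c ∈ S.take n := by
  obtain ⟨j, hj, t, ht⟩ := h
  have hc : S[j]? = some c := by
    rw [← List.head?_drop, ← ht]
    rfl
  exact List.mem_of_getElem? (i := j) (by rw [List.getElem?_take, if_pos hj, hc])

/-- If the factor starts with a nonempty string that already occurs earlier, then the factor itself
occurs earlier and is the longest such prefix of the remainder. -/
theorem IsSFactorization.occursBefore_and_maximal {S : List α} {fs : List (List α)}
    (h : IsSFactorization S fs) (i : ℕ) (hi : i < fs.length) {g : List α} (hg : g ≠ [])
    (hgp : g <+: S.drop ((fs.take i).flatten).length)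
    (hgo : OccursBefore S ((fs.take i).flatten).length g) :
    OccursBefore S ((fs.take i).flatten).length (fs.get ⟨i, hi⟩) ∧
      ∀ f', f' <+: S.drop ((fs.take i).flatten).length →
        OccursBefore S ((fs.take i).flatten).length f' → f'.length ≤ (fs.get ⟨i, hi⟩).length := by
  obtain ⟨c, g, rfl⟩ := List.exists_cons_of_ne_nil hg
  obtain ⟨e, t, het⟩ := List.exists_cons_of_ne_nil (h.2.1 _ (List.get_mem fs ⟨i, hi⟩))
  have hp := h.get_prefix_drop i hi
  have hec : e = c := by
    rw [het] at hp
    obtain ⟨u, hu⟩ := hp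
    rw [← hu, List.cons_append, List.cons_prefix_cons] at hgp
    exact hgp.1.symm
  refine (h.2.2 i hi c (by rw [het, hec]; rfl)).2 ?_
  rw [← h.take_flatten_length i]
  exact hgo.head_mem_take

/-- Case 2 of Lemma 4. With the setup of Lemma 4 (the s-factor `f_j`
starts at 0-indexed position `ℓ0` inside the RL factor of 0-indexed index `d0`,
`q` positions of that run remain, `d ≤ n` i.e. `d0 + 1 < n`, `rs`/`rr` are the RLE
suffix array and its inverse, and `q < p_{d0}` or `q ≤ k`), we have
`|f_j| = q + max M` where `M` contains `0`, the decompressed lcp of the suffixes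
starting at RL indices `rs x₁` and `d0 + 1` when `x₁` (the largest suffix-array
position below `rr (d0+1)` whose suffix starts before RL index `d0 + 1`, not at the
beginning, and is preceded by a run of `a_{d0}` of exponent `≥ q`) exists, and
symmetrically for `x₂` above `rr (d0+1)`. -/
theorem sfactor_length_case2 [LinearOrder α]
    (S : List α) (hS : S ≠ [])
    (l : List (α × ℕ)) (hl : IsRLE S l)
    (fs : List (List α)) (hfs : IsSFactorization S fs)
    (jf : ℕ) (hjf : jf < fs.length)
    (d0 : ℕ) (hd1 : d0 + 1 < l.length)
    (hlo : ((l.take d0).map (·.2)).sum ≤ ((fs.take jf).flatten).length)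
    (hhi : ((fs.take jf).flatten).length < ((l.take (d0 + 1)).map (·.2)).sum)
    (rs rr : Fin l.length → Fin l.length)
    (hrs : Function.Bijective rs)
    (hsorted : ∀ i j : Fin l.length, i < j →
      List.Lex RLLt (l.drop (rs i : ℕ)) (l.drop (rs j : ℕ)))
    (hinv : ∀ h : Fin l.length, rr (rs h) = h ∧ rs (rr h) = h) :
    let ℓ0 := ((fs.take jf).flatten).length
    let q := ((l.take (d0 + 1)).map (·.2)).sum - ℓ0
    let a := (l.get ⟨d0, Nat.lt_of_succ_lt hd1⟩).1
    let pd := (l.get ⟨d0, Nat.lt_of_succ_lt hd1⟩).2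
    let k := (((l.take d0).filter (fun ap => ap.1 = a)).map (·.2)).foldr max 0
    let P₁ : Fin l.length → Prop := fun u =>
      0 < (rs u : ℕ) ∧ (rs u : ℕ) < d0 + 1 ∧ (u : ℕ) < (rr ⟨d0 + 1, hd1⟩ : ℕ) ∧
      (l.get ⟨(rs u : ℕ) - 1, lt_of_le_of_lt (Nat.sub_le _ _) (rs u).isLt⟩).1 = a ∧
      q ≤ (l.get ⟨(rs u : ℕ) - 1, lt_of_le_of_lt (Nat.sub_le _ _) (rs u).isLt⟩).2
    let P₂ : Fin l.length → Prop := fun v =>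
      0 < (rs v : ℕ) ∧ (rs v : ℕ) < d0 + 1 ∧ (rr ⟨d0 + 1, hd1⟩ : ℕ) < (v : ℕ) ∧
      (l.get ⟨(rs v : ℕ) - 1, lt_of_le_of_lt (Nat.sub_le _ _) (rs v).isLt⟩).1 = a ∧
      q ≤ (l.get ⟨(rs v : ℕ) - 1, lt_of_le_of_lt (Nat.sub_le _ _) (rs v).isLt⟩).2
    q < pd ∨ q ≤ k →
      (fs.get ⟨jf, hjf⟩).length =
        q + sSup ({0} ∪
          { w | ∃ x₁, (P₁ x₁ ∧ ∀ u, P₁ u → u ≤ x₁) ∧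
                w = lcpLength (rleDecode (l.drop (rs x₁ : ℕ)))
                      (rleDecode (l.drop (d0 + 1))) } ∪
          { w | ∃ x₂, (P₂ x₂ ∧ ∀ v, P₂ v → x₂ ≤ v) ∧
                w = lcpLength (rleDecode (l.drop (d0 + 1)))
                      (rleDecode (l.drop (rs x₂ : ℕ))) }) := by
  intro ℓ0 q a pd k P₁ P₂ hcase
  have hd0 : d0 < l.length := Nat.lt_of_succ_lt hd1
  have hpd : ((l.take (d0 + 1)).map (·.2)).sum = ((l.take d0).map (·.2)).sum + pd :=
    sum_take_succ l d0 hd0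
  have hq : 1 ≤ q := Nat.sub_pos_of_lt hhi
  have hqℓ : q + ℓ0 = ((l.take (d0 + 1)).map (·.2)).sum := Nat.sub_add_cancel hhi.le
  have hdecode : rleDecode l = S := hl.1
  have hdrop : ∀ (r : ℕ) (hr : r < l.length) (j : ℕ), ((l.take r).map (·.2)).sum ≤ j →
      j ≤ ((l.take (r + 1)).map (·.2)).sum →
      S.drop j = List.replicate (((l.take (r + 1)).map (·.2)).sum - j) l[r].1 ++
        rleDecode (l.drop (r + 1)) := by
    intro r hr j h₁ h₂
    rw [← hdecode]
    exact drop_rleDecode_within_run l r hr j h₁ h₂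
  have hrest : S.drop ℓ0 = List.replicate q a ++ rleDecode (l.drop (d0 + 1)) :=
    hdrop d0 hd0 ℓ0 hlo hhi.le
  -- a common continuation after an earlier run of `a` of exponent at least `q` yields an
  -- earlier occurrence
  have hocc : ∀ (r : ℕ) (hr : r < d0), l[r].1 = a → q ≤ l[r].2 → ∀ w,
      w <+: rleDecode (l.drop (r + 1)) → OccursBefore S ℓ0 (List.replicate q a ++ w) := by
    intro r hr ha hqr w hw
    have hr' : r < l.length := hr.trans hd0
    have hs := sum_take_succ l r hr'
    have hle := sum_take_mono l (show r + 1 ≤ d0 from hr)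
    refine ⟨((l.take (r + 1)).map (·.2)).sum - q, by omega, ?_⟩
    rw [hdrop r hr' _ (by omega) (by omega), ha, Nat.sub_sub_self (by omega)]
    exact (List.prefix_append_right_inj _).2 hw
  have hblock : OccursBefore S ℓ0 (List.replicate q a) := by
    rcases hcase with h | h
    · refine ⟨ℓ0 - 1, by omega, ?_⟩
      rw [hdrop d0 hd0 (ℓ0 - 1) (by omega) (by omega),
        show ((l.take (d0 + 1)).map (·.2)).sum - (ℓ0 - 1) = q + 1 by omega,
        ← List.replicate_append_replicate, List.append_assoc]
      exact List.prefix_append _ _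
    · obtain ⟨p, hp, hqp⟩ := exists_mem_le_of_le_foldr_max hq _ h
      simp only [List.mem_map, List.mem_filter, decide_eq_true_eq] at hp
      obtain ⟨ap, ⟨hmem, hap⟩, rfl⟩ := hp
      obtain ⟨r, hr, rfl⟩ := List.getElem_of_mem hmem
      have hr' : r < d0 := by
        rw [List.length_take] at hr
        omega
      rw [List.getElem_take] at hap hqp
      simpa using hocc r hr' hap hqp [] (List.nil_prefix)
  obtain ⟨hGocc, hGmax⟩ := hfs.occursBefore_and_maximal jf hjf
    (g := List.replicate q a) (by simp; omega) (hrest ▸ List.prefix_append _ _) hblock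
  have hGp := hfs.get_prefix_drop jf hjf
  generalize hG : fs.get ⟨jf, hjf⟩ = G at hGocc hGmax hGp ⊢
  have hqG : q ≤ G.length := by
    simpa using hGmax _ (hrest ▸ List.prefix_append _ _) hblock
  have hcand : ∀ u : Fin l.length, 0 < (rs u : ℕ) → (rs u : ℕ) < d0 + 1 →
      (l.get ⟨(rs u : ℕ) - 1, lt_of_le_of_lt (Nat.sub_le _ _) (rs u).isLt⟩).1 = a →
      q ≤ (l.get ⟨(rs u : ℕ) - 1, lt_of_le_of_lt (Nat.sub_le _ _) (rs u).isLt⟩).2 →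
      ∀ w, w <+: rleDecode (l.drop (rs u : ℕ)) → w <+: rleDecode (l.drop (d0 + 1)) →
        q + w.length ≤ G.length := by
    intro u h0 hu ha hqu w hwu hwd
    have hw := hocc ((rs u : ℕ) - 1) (by omega) ha hqu w (by
      rwa [Nat.sub_add_cancel h0])
    have := hGmax _ (by
      change _ <+: S.drop ℓ0
      rw [hrest]
      exact (List.prefix_append_right_inj _).2 hwd) hw
    simpa using this
  set M : Set ℕ := ({0} ∪
          { w | ∃ x₁, (P₁ x₁ ∧ ∀ u, P₁ u → u ≤ x₁) ∧
                w = lcpLength (rleDecode (l.drop (rs x₁ : ℕ)))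
                      (rleDecode (l.drop (d0 + 1))) } ∪
          { w | ∃ x₂, (P₂ x₂ ∧ ∀ v, P₂ v → x₂ ≤ v) ∧
                w = lcpLength (rleDecode (l.drop (d0 + 1)))
                      (rleDecode (l.drop (rs x₂ : ℕ))) })
  have hbound : ∀ w ∈ M, q + w ≤ G.length := by
    rintro w ((rfl | ⟨x, ⟨hx, -⟩, rfl⟩) | ⟨x, ⟨hx, -⟩, rfl⟩)
    · simpa using hqG
    · obtain ⟨f, hf, hf₁, hf₂⟩ := exists_prefix_length_eq_lcpLength
        (rleDecode (l.drop (rs x : ℕ))) (rleDecode (l.drop (d0 + 1)))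
      rw [← hf]
      exact hcand x hx.1 hx.2.1 hx.2.2.2.1 hx.2.2.2.2 f hf₁ hf₂
    · obtain ⟨f, hf, hf₁, hf₂⟩ := exists_prefix_length_eq_lcpLength
        (rleDecode (l.drop (d0 + 1))) (rleDecode (l.drop (rs x : ℕ)))
      rw [← hf]
      exact hcand x hx.1 hx.2.1 hx.2.2.2.1 hx.2.2.2.2 f hf₂ hf₁
  have hattained : ∃ w ∈ M, G.length ≤ q + w := by
    have hGp' : G <+: List.replicate q a ++ rleDecode (l.drop (d0 + 1)) := hrest ▸ hGp
    obtain ⟨f, rfl⟩ : List.replicate q a <+: G := by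
      exact List.prefix_of_prefix_length_le (List.prefix_append _ _) hGp' (by simpa using hqG)
    have hfD := (List.prefix_append_right_inj _).1 hGp'
    rcases f with _ | ⟨b, t⟩
    · exact ⟨0, Or.inl (Or.inl rfl), by simp⟩
    have hba : b ≠ a := by
      rintro rfl
      exact hl.not_cons_prefix_drop_succ d0 hd0 t hfD
    obtain ⟨j, hj, hjp⟩ := hGocc
    have hjS : j < S.length := by
      by_contra h
      rw [List.drop_of_length_le (by omega)] at hjp
      simp at hjp
    obtain ⟨r, hr, hr₁, hr₂⟩ := exists_run_of_lt_length l j (by rwa [hdecode])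
    rw [hdrop r hr j hr₁ hr₂.le] at hjp
    obtain ⟨har, hmq, hfr⟩ := eq_of_replicate_append_prefix hba hq (Nat.sub_pos_of_lt hr₂)
      (hl.not_cons_prefix_drop_succ r hr) hjp
    have hj' : j < ℓ0 := hj
    have hrd : r < d0 := by
      rcases lt_trichotomy r d0 with h | rfl | h
      · exact h
      · omega
      · have := sum_take_mono l (show d0 + 1 ≤ r from h)
        omega
    have hqr : q ≤ l[r].2 := by
      have := sum_take_succ l r hr
      omega
    have hr1 : r + 1 < l.length := by omega
    obtain ⟨u, hu⟩ := hrs.2 ⟨r + 1, hr1⟩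
    have huv : (rs u : ℕ) = r + 1 := by rw [hu]
    have hD : rs (rr ⟨d0 + 1, hd1⟩) = ⟨d0 + 1, hd1⟩ := (hinv _).2
    have hne : u ≠ rr ⟨d0 + 1, hd1⟩ := by
      rintro rfl
      rw [hD] at huv
      simp at huv
      omega
    have hu' : 0 < (rs u : ℕ) ∧ (rs u : ℕ) < d0 + 1 ∧
        (l.get ⟨(rs u : ℕ) - 1, lt_of_le_of_lt (Nat.sub_le _ _) (rs u).isLt⟩).1 = a ∧
        q ≤ (l.get ⟨(rs u : ℕ) - 1, lt_of_le_of_lt (Nat.sub_le _ _) (rs u).isLt⟩).2 := by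
      simp only [huv, Nat.add_sub_cancel]
      exact ⟨by omega, by omega, har.symm, hqr⟩
    have hfu : b :: t <+: rleDecode (l.drop (rs u : ℕ)) := by rwa [huv]
    rcases lt_or_gt_of_ne hne with hlt | hlt
    · have hPu : P₁ u := ⟨hu'.1, hu'.2.1, hlt, hu'.2.2⟩
      obtain ⟨x, hx, hxmax⟩ := Set.exists_max_image {v | P₁ v} id (Set.toFinite _) ⟨u, hPu⟩
      refine ⟨_, Or.inl (Or.inr ⟨x, ⟨hx, hxmax⟩, rfl⟩), ?_⟩
      have hfx : b :: t <+: rleDecode (l.drop (rs x : ℕ)) := by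
        rcases (show u ≤ x from hxmax u hPu).eq_or_lt with rfl | hux
        · exact hfu
        · have h₂ := hsorted x (rr ⟨d0 + 1, hd1⟩) hx.2.2.1
          rw [hD] at h₂
          exact prefix_rleDecode_of_lex_between (hl.drop _) (hl.drop _) (hsorted u x hux) h₂
            hfu hfD
      simpa using le_lcpLength hfx hfD
    · have hPu : P₂ u := ⟨hu'.1, hu'.2.1, hlt, hu'.2.2⟩
      obtain ⟨x, hx, hxmin⟩ := Set.exists_min_image {v | P₂ v} id (Set.toFinite _) ⟨u, hPu⟩
      refine ⟨_, Or.inr ⟨x, ⟨hx, hxmin⟩, rfl⟩, ?_⟩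
      have hfx : b :: t <+: rleDecode (l.drop (rs x : ℕ)) := by
        rcases (show x ≤ u from hxmin u hPu).eq_or_lt with rfl | hux
        · exact hfu
        · have h₂ := hsorted (rr ⟨d0 + 1, hd1⟩) x hx.2.2.1
          rw [hD] at h₂
          exact prefix_rleDecode_of_lex_between (hl.drop _) (hl.drop _) h₂ (hsorted x u hux)
            hfD hfu
      simpa using le_lcpLength hfD hfx
  obtain ⟨w, hw, hGw⟩ := hattained
  have hgreatest : IsGreatest M w := ⟨hw, fun v hv => by
    have := hbound v hv
    omega⟩
  rw [hgreatest.csSup_eq]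
  exact le_antisymm hGw (hbound w hw)
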